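/- arXiv:2006.07948 — 2 statements merged into one kernel-verified Lean document; each statement's English description precedes it below -/
import Mathlib

section
/- Let Ω ⊆ ℝⁿ be a nonempty open set and let X(Ω) be a Banach function space over Ω (rearrangement invariance is not assumed). If X(Ω) has absolutely continuous norm, then the set C_0^∞(Ω) of smooth compactly supported functions on Ω is dense in X(Ω). -/
open MeasureTheory ENNReal NNReal Set Filter Topology

noncomputable section

/-- A Banach function norm over the measure space `(α, μ)`: a functional `ρ` on nonnegative
(extended-real-valued) measurable functions satisfying the norm axioms, the lattice property,
the Fatou property, finiteness on indicators of sets of finite measure, and the local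
integrability axiom. -/
structure BanachFunctionNorm (α : Type*) [MeasurableSpace α] (μ : Measure α) where
  /-- the functional `ρ : M⁺ → [0,∞]` -/
  ρ : (α → ℝ≥0∞) → ℝ≥0∞
  eq_zero_iff : ∀ f : α → ℝ≥0∞, Measurable f → (ρ f = 0 ↔ f =ᵐ[μ] 0)
  smul : ∀ (f : α → ℝ≥0∞) (c : ℝ≥0), Measurable f → ρ (fun x => (c : ℝ≥0∞) * f x) = (c : ℝ≥0∞) * ρ f
  add_le : ∀ f g : α → ℝ≥0∞, Measurable f → Measurable g → ρ (f + g) ≤ ρ f + ρ g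
  mono : ∀ f g : α → ℝ≥0∞, Measurable f → Measurable g → (∀ᵐ x ∂μ, g x ≤ f x) → ρ g ≤ ρ f
  fatou : ∀ (F : ℕ → α → ℝ≥0∞) (f : α → ℝ≥0∞), (∀ j, Measurable (F j)) → Measurable f →
    (∀ᵐ x ∂μ, Monotone fun j => F j x) → (∀ᵐ x ∂μ, (⨆ j, F j x) = f x) →
    ρ f = ⨆ j, ρ (F j)
  indicator_lt_top : ∀ E : Set α, MeasurableSet E → μ E < ∞ → ρ (E.indicator 1) < ∞
  setIntegral_le : ∀ E : Set α, MeasurableSet E → μ E < ∞ → ∃ C : ℝ≥0∞, C < ∞ ∧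
    ∀ f : α → ℝ≥0∞, Measurable f → ∫⁻ x in E, f x ∂μ ≤ C * ρ f

/-- A Banach function norm is rearrangement invariant if it takes the same value on
equimeasurable functions. -/
def BanachFunctionNorm.RearrangementInvariant {α : Type*} [MeasurableSpace α]
    {μ : Measure α} (X : BanachFunctionNorm α μ) : Prop :=
  ∀ f g : α → ℝ≥0∞, Measurable f → Measurable g →
    (∀ t : ℝ≥0∞, 0 < t → μ {x | t < f x} = μ {x | t < g x}) → X.ρ f = X.ρ g

/-- The Banach function space determined by `X` has absolutely continuous norm:
`‖f χ_{E_k}‖ → 0` for every `f` in the space and every sequence of measurable sets `E_k`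
whose indicator functions tend to `0` a.e. -/
def BanachFunctionNorm.HasAbsolutelyContinuousNorm {α : Type*} [MeasurableSpace α]
    {μ : Measure α} (X : BanachFunctionNorm α μ) : Prop :=
  ∀ f : α → ℝ≥0∞, Measurable f → X.ρ f < ∞ →
    ∀ E : ℕ → Set α, (∀ j, MeasurableSet (E j)) → (∀ᵐ x ∂μ, ∀ᶠ j in atTop, x ∉ E j) →
    Tendsto (fun j => X.ρ ((E j).indicator f)) atTop (𝓝 0)

end

/-- Dominated convergence in a Banach function space with absolutely continuous norm. -/
theorem BanachFunctionNorm.HasAbsolutelyContinuousNorm.tendsto_of_dominated {α : Type*}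
    [MeasurableSpace α] {μ : Measure α} {X : BanachFunctionNorm α μ}
    (hac : X.HasAbsolutelyContinuousNorm) {F : α → ℝ≥0∞} (hF : Measurable F) (hFX : X.ρ F < ∞)
    {h : ℕ → α → ℝ≥0∞} (hm : ∀ k, Measurable (h k)) (hle : ∀ k, ∀ᵐ x ∂μ, h k x ≤ F x)
    (hlim : ∀ᵐ x ∂μ, Tendsto (fun k => h k x) atTop (𝓝 0)) :
    Tendsto (fun k => X.ρ (h k)) atTop (𝓝 0) := by
  rw [ENNReal.tendsto_nhds_zero]
  intro ε hε
  obtain ⟨δ, hδ, hδε⟩ : ∃ δ : ℝ≥0, 0 < δ ∧ (δ : ℝ≥0∞) * X.ρ F < ε / 2 :=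
    ENNReal.exists_nnreal_pos_mul_lt hFX.ne (ENNReal.half_pos hε.ne').ne'
  let E : ℕ → Set α := fun k => {x | (δ : ℝ≥0∞) * F x < h k x}
  have hE : ∀ k, MeasurableSet (E k) := fun k => measurableSet_lt (hF.const_mul _) (hm k)
  have hE_lim : ∀ᵐ x ∂μ, ∀ᶠ k in atTop, x ∉ E k := by
    filter_upwards [hlim, ae_all_iff.2 hle] with x hx hxF
    rcases eq_or_ne (F x) 0 with h0 | h0
    · exact Eventually.of_forall fun k => by simpa [E, h0] using hxF k
    · have hpos : 0 < (δ : ℝ≥0∞) * F x :=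
        ENNReal.mul_pos (ENNReal.coe_pos.2 hδ).ne' h0
      filter_upwards [hx.eventually_le_const hpos] with k hk
      exact not_lt.2 hk
  filter_upwards [(ENNReal.tendsto_nhds_zero.1 (hac F hF hFX E hE hE_lim)) (ε / 2)
    (ENNReal.half_pos hε.ne')] with k hk
  have hδF : Measurable fun x => (δ : ℝ≥0∞) * F x := hF.const_mul _
  have hEF : Measurable ((E k).indicator F) := hF.indicator (hE k)
  calc X.ρ (h k) ≤ X.ρ ((fun x => (δ : ℝ≥0∞) * F x) + (E k).indicator F) := by
        refine X.mono _ _ (hδF.add hEF) (hm k) ?_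
        filter_upwards [hle k] with x hx
        by_cases hxE : x ∈ E k
        · simpa [hxE] using hx.trans le_add_self
        · simpa [hxE] using not_lt.1 hxE
    _ ≤ X.ρ (fun x => (δ : ℝ≥0∞) * F x) + X.ρ ((E k).indicator F) := X.add_le _ _ hδF hEF
    _ ≤ ε / 2 + ε / 2 := by
        rw [X.smul F δ hF]
        exact add_le_add hδε.le hk
    _ = ε := ENNReal.add_halves ε

/-- The norm of the difference of two functions satisfies the triangle inequality. -/
theorem BanachFunctionNorm.sub_le_add {α : Type*} [MeasurableSpace α] {μ : Measure α}
    (X : BanachFunctionNorm α μ) {f g h : α → ℝ} (hf : Measurable f) (hg : Measurable g)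
    (hh : Measurable h) :
    X.ρ (fun x => ENNReal.ofReal |f x - h x|) ≤
      X.ρ (fun x => ENNReal.ofReal |f x - g x|) + X.ρ (fun x => ENNReal.ofReal |g x - h x|) := by
  have meas : ∀ {u v : α → ℝ}, Measurable u → Measurable v →
      Measurable fun x => ENNReal.ofReal |u x - v x| := fun hu hv => by fun_prop
  refine (X.mono _ _ ((meas hf hg).add (meas hg hh)) (meas hf hh) (ae_of_all _ fun x => ?_)).trans
    (X.add_le _ _ (meas hf hg) (meas hg hh))
  simp only [Pi.add_apply]
  rw [← ENNReal.ofReal_add (abs_nonneg _) (abs_nonneg _)]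
  exact ENNReal.ofReal_le_ofReal (abs_sub_le _ _ _)

/-- A bounded measurable function supported in a compact subset of an open set `Ω` is the a.e. limit
of a uniformly bounded sequence of smooth functions supported in a common compact subset of `Ω`. -/
theorem exists_contDiff_seq_tendsto_ae_of_bounded {E : Type*} [NormedAddCommGroup E]
    [NormedSpace ℝ E] [FiniteDimensional ℝ E] [MeasurableSpace E] [BorelSpace E] (μ : Measure E)
    [μ.IsAddHaarMeasure] {Ω K : Set E} (hΩ : IsOpen Ω) (hK : IsCompact K) (hKΩ : K ⊆ Ω)
    {f : E → ℝ} (hf : Measurable f) {M : ℝ} (hM : ∀ x, |f x| ≤ M)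
    (hfK : Function.support f ⊆ K) :
    ∃ (L : Set E) (g : ℕ → E → ℝ), IsCompact L ∧ L ⊆ Ω ∧ K ⊆ L ∧
      (∀ k, ContDiff ℝ (⊤ : ℕ∞) (g k)) ∧ (∀ k, tsupport (g k) ⊆ L) ∧
      (∀ k x, |f x - g k x| ≤ 2 * M) ∧
      ∀ᵐ x ∂μ, Tendsto (fun k => g k x) atTop (𝓝 (f x)) := by
  obtain ⟨δ, hδ, hδΩ⟩ := hK.exists_cthickening_subset_open hΩ hKΩ
  have hf_loc : LocallyIntegrable f μ :=
    (locallyIntegrable_const M).mono hf.aestronglyMeasurable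
      (ae_of_all _ fun x => (hM x).trans (le_abs_self M))
  let φ : ℕ → ContDiffBump (0 : E) := fun k =>
    { rIn := δ / (k + 1) / 2
      rOut := δ / (k + 1)
      rIn_pos := by positivity
      rIn_lt_rOut := half_lt_self (by positivity) }
  have hφ : ∀ k, (φ k).rOut ≤ δ := fun k => div_le_self hδ.le (by simp)
  have hφ_lim : Tendsto (fun k => (φ k).rOut) atTop (𝓝 0) := by
    simpa [φ, div_eq_mul_inv] using (tendsto_one_div_add_atTop_nhds_zero_nat (𝕜 := ℝ)).const_mul δ
  refine ⟨Metric.cthickening δ K,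
    fun k => MeasureTheory.convolution ((φ k).normed μ) f (ContinuousLinearMap.lsmul ℝ ℝ) μ,
    hK.cthickening, hδΩ, Metric.self_subset_cthickening K, fun k => ?_, fun k => ?_,
    fun k x => ?_, ?_⟩
  · exact (φ k).hasCompactSupport_normed.contDiff_convolution_left _ (φ k).contDiff_normed hf_loc
  · refine closure_minimal (fun x hx => ?_) Metric.isClosed_cthickening
    obtain ⟨y, hy, z, hz, rfl⟩ := support_convolution_subset_swap _ hx
    rw [(φ k).support_normed_eq, mem_ball_zero_iff] at hz
    refine Metric.mem_cthickening_of_dist_le _ y δ K (hfK hy) ?_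
    simpa using hz.le.trans (hφ k)
  · rw [abs_sub_comm, ← Real.dist_eq]
    refine (φ k).dist_normed_convolution_le hf.aestronglyMeasurable fun y _ => ?_
    rw [Real.dist_eq]
    linarith [abs_sub (f y) (f x), hM x, hM y]
  · refine ContDiffBump.ae_convolution_tendsto_right_of_locallyIntegrable (K := 2) hφ_lim
      (Eventually.of_forall fun k => ?_) hf_loc
    simp only [φ]
    linarith

/-- Let `Ω ⊆ ℝⁿ` be a nonempty open set and `X(Ω)` a Banach function space
over `Ω` (rearrangement invariance is not assumed). If `X(Ω)` has absolutely continuous norm,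
then the smooth compactly supported functions on `Ω` are dense in `X(Ω)`. -/
theorem smooth_compactly_supported_dense_of_acNorm
    (n : ℕ) (Ω : Set (Fin n → ℝ)) (hΩ : IsOpen Ω) (hne : Ω.Nonempty)
    (X : BanachFunctionNorm (Fin n → ℝ) ((volume : Measure (Fin n → ℝ)).restrict Ω))
    (hac : X.HasAbsolutelyContinuousNorm) :
    ∀ f : (Fin n → ℝ) → ℝ, Measurable f →
      X.ρ (fun x => ENNReal.ofReal |f x|) < ∞ →
      ∀ ε : ℝ≥0∞, 0 < ε →
        ∃ g : (Fin n → ℝ) → ℝ, ContDiff ℝ (⊤ : ℕ∞) g ∧ HasCompactSupport g ∧ tsupport g ⊆ Ω ∧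
          X.ρ (fun x => ENNReal.ofReal |f x - g x|) < ε := by
  intro f hf hfX ε hε
  have hε2 : 0 < ε / 2 := ENNReal.half_pos hε.ne'
  have meas : ∀ {u v : (Fin n → ℝ) → ℝ}, Measurable u → Measurable v →
      Measurable fun x => ENNReal.ofReal |u x - v x| := fun hu hv => by fun_prop
  obtain ⟨F, hF_closed, hFΩ, hF_union, hF_mono⟩ := hΩ.exists_iUnion_isClosed
  let K : ℕ → Set (Fin n → ℝ) := fun m => F m ∩ Metric.closedBall 0 m
  have hK : ∀ m, IsCompact (K m) := fun m =>
    (isCompact_closedBall _ _).inter_left (hF_closed m)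
  let A : ℕ → Set (Fin n → ℝ) := fun m => K m ∩ {x | |f x| ≤ m}
  have hA : ∀ m, MeasurableSet (A m) := fun m =>
    (hK m).measurableSet.inter (measurableSet_le hf.abs measurable_const)
  have htrunc : Tendsto (fun m => X.ρ fun x => ENNReal.ofReal |f x - (A m).indicator f x|) atTop
      (𝓝 0) := by
    refine hac.tendsto_of_dominated (by fun_prop) hfX (fun m => meas hf (hf.indicator (hA m)))
      (fun m => ae_of_all _ fun x => ENNReal.ofReal_le_ofReal ?_) ?_
    · by_cases hx : x ∈ A m <;> simp [hx]
    · filter_upwards [ae_restrict_mem hΩ.measurableSet] with x hx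
      obtain ⟨i, hi⟩ := mem_iUnion.1 (hF_union.symm ▸ hx)
      refine tendsto_const_nhds.congr' ?_
      filter_upwards [eventually_ge_atTop i,
        tendsto_natCast_atTop_atTop.eventually_ge_atTop ‖x‖,
        tendsto_natCast_atTop_atTop.eventually_ge_atTop |f x|] with m hm hxm hfm
      have hxA : x ∈ A m := ⟨⟨hF_mono hm hi, by simpa using hxm⟩, hfm⟩
      simp [hxA]
  obtain ⟨m, hm⟩ := (htrunc.eventually_lt_const hε2).exists
  have hbound : ∀ x, |(A m).indicator f x| ≤ m := fun x => by
    by_cases hx : x ∈ A m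
    · simpa [hx] using hx.2
    · simp [hx]
  obtain ⟨L, g, hL, hLΩ, hKL, hg_smooth, hg_supp, hg_bound, hg_lim⟩ :=
    exists_contDiff_seq_tendsto_ae_of_bounded volume hΩ (hK m) (inter_subset_left.trans (hFΩ m))
      (hf.indicator (hA m)) hbound (support_indicator_subset.trans inter_subset_left)
  have hg_meas : ∀ k, Measurable (g k) := fun k => (hg_smooth k).continuous.measurable
  have hL_ind : Measurable (L.indicator (1 : (Fin n → ℝ) → ℝ≥0∞)) :=
    measurable_one.indicator hL.measurableSet
  have happrox : Tendsto (fun k => X.ρ fun x => ENNReal.ofReal |(A m).indicator f x - g k x|) atTop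
      (𝓝 0) := by
    refine hac.tendsto_of_dominated
      (F := fun x => ((2 * m : ℝ≥0) : ℝ≥0∞) * L.indicator 1 x) (hL_ind.const_mul _) ?_
      (fun k => meas (hf.indicator (hA m)) (hg_meas k)) (fun k => ae_of_all _ fun x => ?_) ?_
    · rw [X.smul _ _ hL_ind]
      exact ENNReal.mul_lt_top ENNReal.coe_lt_top (X.indicator_lt_top L hL.measurableSet
        ((Measure.restrict_apply_le _ _).trans_lt hL.measure_lt_top))
    · by_cases hx : x ∈ L
      · simpa [hx, ENNReal.ofReal_mul] using ENNReal.ofReal_le_ofReal (hg_bound k x)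
      · have hxA : x ∉ A m := fun h => hx (hKL h.1)
        have hgx : g k x = 0 := image_eq_zero_of_notMem_tsupport fun h => hx (hg_supp k h)
        simp [hxA, hgx]
    · filter_upwards [ae_restrict_of_ae hg_lim] with x hx
      simpa using ENNReal.tendsto_ofReal (hx.const_sub ((A m).indicator f x)).abs
  obtain ⟨k, hk⟩ := (happrox.eventually_lt_const hε2).exists
  refine ⟨g k, hg_smooth k, hL.of_isClosed_subset (isClosed_tsupport _) (hg_supp k),
    (hg_supp k).trans hLΩ, ?_⟩
  calc X.ρ (fun x => ENNReal.ofReal |f x - g k x|)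
      ≤ _ := X.sub_le_add hf (hf.indicator (hA m)) (hg_meas k)
    _ < ε / 2 + ε / 2 := ENNReal.add_lt_add hm hk
    _ = ε := ENNReal.add_halves ε
end

section
/- Let n ≥ 2, k ∈ {1,…,n−1}, and −∞ < a_i < b_i < ∞ for i = 1,…,n−k; set D = ℝ^k × ∏_{i=1}^{n−k}(a_i,b_i) ⊆ ℝⁿ. Let either p ∈ [1,n) and q ∈ [p, np/(n−p)], or p ∈ [n,∞) and q ∈ [p,∞). Then the canonical Sobolev embedding I: W_0^{1,p}(D) ↪ L^q(D) is bounded and maximally noncompact: e_m(I) = ‖I‖ for every m ∈ ℕ. -/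
open MeasureTheory ENNReal Set Filter Topology

noncomputable section

/-- The `i`-th partial derivative of `u : ℝⁿ → ℝ`. -/
def pder {n : ℕ} (i : Fin n) (u : (Fin n → ℝ) → ℝ) (x : Fin n → ℝ) : ℝ :=
  fderiv ℝ u x (Pi.single i 1)

/-- `u` is a smooth function compactly supported in the open set `D`. -/
def IsTestFun {n : ℕ} (D : Set (Fin n → ℝ)) (u : (Fin n → ℝ) → ℝ) : Prop :=
  ContDiff ℝ (⊤ : ℕ∞) u ∧ HasCompactSupport u ∧ tsupport u ⊆ D

/-- The strip-like domain `ℝᵏ × ∏_{i ≥ k} (aᵢ, bᵢ)`, realized as a subset of `ℝⁿ`: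
the coordinates `i < k` are free, the coordinates `i ≥ k` are constrained to `(aᵢ, bᵢ)`. -/
def stripDomain (n k : ℕ) (a b : Fin n → ℝ) : Set (Fin n → ℝ) :=
  {x | ∀ i : Fin n, k ≤ (i : ℕ) → x i ∈ Set.Ioo (a i) (b i)}

/-- The ambient space `V = L^p(ℝⁿ; ℓ^p(ℝ^{n+1}))`, in which the Sobolev space `W^{1,p}_0`
is realized as the closure of the set of "jets" `(u, ∇u)` of test functions. -/
abbrev Vsp (n : ℕ) (p : ℝ≥0∞) [Fact (1 ≤ p)] :=
  Lp (PiLp p (fun _ : Fin (n + 1) => ℝ)) p (volume : Measure (Fin n → ℝ))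

/-- The "jet" `(u, ∂₁u, …, ∂ₙu)` of a function, valued in `ℓ^p(ℝ^{n+1})`. -/
def jet {n : ℕ} (p : ℝ≥0∞) (u : (Fin n → ℝ) → ℝ) (x : Fin n → ℝ) :
    PiLp p (fun _ : Fin (n + 1) => ℝ) :=
  (WithLp.equiv p (∀ _ : Fin (n + 1), ℝ)).symm (Fin.cons (u x) (fun i => pder i u x))

/-- `W^{1,p}_0(D)` realized as a closed subspace of `V`:
the closure of the subspace of jets of test functions supported in `D`.
The (subspace) norm of the jet of `u` is exactly
`(‖u‖_p^p + ‖ |∇u|_{ℓ^p} ‖_p^p)^{1/p}`, i.e., the `W^{1,p}`-norm of `u`. -/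
def W0sub {n : ℕ} (p : ℝ≥0∞) [Fact (1 ≤ p)] (D : Set (Fin n → ℝ)) : Submodule ℝ (Vsp n p) :=
  (Submodule.span ℝ {f : Vsp n p | ∃ u : (Fin n → ℝ) → ℝ, IsTestFun D u ∧
    (f : (Fin n → ℝ) → PiLp p (fun _ : Fin (n + 1) => ℝ)) =ᵐ[volume] jet p u}).topologicalClosure

instance W0sub.completeSpace {n : ℕ} (p : ℝ≥0∞) [Fact (1 ≤ p)] (D : Set (Fin n → ℝ)) :
    CompleteSpace (W0sub (n := n) p D) :=
  (Submodule.isClosed_topologicalClosure _).completeSpace_coe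

/-- Projection of a jet onto its zeroth (function) component. -/
def proj0 (n : ℕ) (p : ℝ≥0∞) [Fact (1 ≤ p)] : PiLp p (fun _ : Fin (n + 1) => ℝ) →L[ℝ] ℝ :=
  (ContinuousLinearMap.proj (0 : Fin (n + 1))).comp
    (PiLp.continuousLinearEquiv p ℝ (fun _ : Fin (n + 1) => ℝ)).toContinuousLinearMap

/-- Projection of a jet onto its gradient components, valued in `ℓ^p(ℝⁿ)`. -/
def projGrad (n : ℕ) (p : ℝ≥0∞) [Fact (1 ≤ p)] :
    PiLp p (fun _ : Fin (n + 1) => ℝ) →L[ℝ] PiLp p (fun _ : Fin n => ℝ) :=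
  ((PiLp.continuousLinearEquiv p ℝ (fun _ : Fin n => ℝ)).symm.toContinuousLinearMap).comp
    ((ContinuousLinearMap.pi fun i : Fin n => ContinuousLinearMap.proj (R := ℝ) i.succ).comp
      (PiLp.continuousLinearEquiv p ℝ (fun _ : Fin (n + 1) => ℝ)).toContinuousLinearMap)

/-- The canonical Sobolev embedding `I : W^{1,p}_0(D) → L^p(D)` (as a map into `L^p(ℝⁿ)`;
all functions in `W^{1,p}_0(D)` vanish a.e. outside `D`). -/
def SobolevEmb {n : ℕ} (p : ℝ≥0∞) [Fact (1 ≤ p)] (D : Set (Fin n → ℝ)) :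
    W0sub (n := n) p D →L[ℝ] Lp ℝ p (volume : Measure (Fin n → ℝ)) :=
  ((proj0 n p).compLpL p volume).comp (W0sub p D).subtypeL

/-- The gradient map `W^{1,p}_0(D) → L^p(D; ℓ^p(ℝⁿ))`, `u ↦ ∇u`. -/
def SobolevGrad {n : ℕ} (p : ℝ≥0∞) [Fact (1 ≤ p)] (D : Set (Fin n → ℝ)) :
    W0sub (n := n) p D →L[ℝ] Lp (PiLp p (fun _ : Fin n => ℝ)) p (volume : Measure (Fin n → ℝ)) :=
  ((projGrad n p).compLpL p volume).comp (W0sub p D).subtypeL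

/-- `π_p = 2 ∫₀¹ (1 - sᵖ)^{-1/p} ds`. -/
def piP (p : ℝ) : ℝ := 2 * ∫ s in (0 : ℝ)..1, (1 - s ^ p) ^ (-1 / p)

/-- The inverse of `t ↦ ∫₀ᵗ (1 - sᵖ)^{-1/p} ds` on `[0,1]`; this is `sin_p` on `[0, π_p/2]`. -/
def sinpHalf (p : ℝ) : ℝ → ℝ :=
  Function.invFunOn (fun t : ℝ => ∫ s in (0 : ℝ)..t, (1 - s ^ p) ^ (-1 / p)) (Set.Icc 0 1)

/-- `sin_p` on `[0, π_p]`, by reflection around `π_p/2`. -/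
def sinpBase (p t : ℝ) : ℝ :=
  if t ≤ piP p / 2 then sinpHalf p t else sinpHalf p (piP p - t)

/-- `sin_p` on `[-π_p, π_p]`, by odd reflection. -/
def sinpSym (p t : ℝ) : ℝ := if 0 ≤ t then sinpBase p t else -sinpBase p (-t)

/-- The generalized sine function `sin_p`, extended `2π_p`-periodically to all of `ℝ`. -/
def sinp (p t : ℝ) : ℝ :=
  sinpSym p (t - 2 * piP p * ⌊(t + piP p) / (2 * piP p)⌋)

/-- The generalized cosine function `cos_p = (sin_p)'`. -/
def cosp (p : ℝ) : ℝ → ℝ := deriv (sinp p)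

/-- The `m`-th entropy number of a bounded linear operator: the infimum of all `ε > 0` such
that the image of the closed unit ball can be covered by `2^{m-1}` balls of radius `ε`. -/
def entropyNumber {X Y : Type*} [NormedAddCommGroup X] [NormedSpace ℝ X]
    [NormedAddCommGroup Y] [NormedSpace ℝ Y] (m : ℕ) (T : X →L[ℝ] Y) : ℝ :=
  sInf {ε : ℝ | 0 < ε ∧ ∃ c : Fin (2 ^ (m - 1)) → Y,
    ∀ x : X, ‖x‖ ≤ 1 → ∃ j, ‖T x - c j‖ ≤ ε}

end

theorem contDiff_one_of_isTestFun {n : ℕ} {D : Set (Fin n → ℝ)} {u : (Fin n → ℝ) → ℝ}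
    (hu : IsTestFun D u) : ContDiff ℝ 1 u :=
  hu.1.of_le (by exact_mod_cast le_top)

theorem norm_le_norm_jet {n : ℕ} (p : ℝ≥0∞) [Fact (1 ≤ p)] (u : (Fin n → ℝ) → ℝ)
    (x : Fin n → ℝ) : ‖u x‖ ≤ ‖jet p u x‖ :=
  PiLp.norm_apply_le (jet p u x) 0

theorem norm_pder_le_norm_jet {n : ℕ} (p : ℝ≥0∞) [Fact (1 ≤ p)] (u : (Fin n → ℝ) → ℝ)
    (x : Fin n → ℝ) (i : Fin n) : ‖pder i u x‖ ≤ ‖jet p u x‖ :=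
  PiLp.norm_apply_le (jet p u x) i.succ

theorem norm_fderiv_le_norm_jet {n : ℕ} (p : ℝ≥0∞) [Fact (1 ≤ p)] (u : (Fin n → ℝ) → ℝ)
    (x : Fin n → ℝ) : ‖fderiv ℝ u x‖ ≤ n * ‖jet p u x‖ := by
  refine ContinuousLinearMap.opNorm_le_bound _ (by positivity) fun v => ?_
  have hv : fderiv ℝ u x v = ∑ i, v i * pder i u x := by
    conv_lhs => rw [pi_eq_sum_univ' v]
    simp [map_sum, pder]
  rw [hv]
  calc ‖∑ i, v i * pder i u x‖ ≤ ∑ i : Fin n, ‖v‖ * ‖jet p u x‖ := by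
        refine norm_sum_le_of_le _ fun i _ => ?_
        rw [norm_mul]
        gcongr
        · exact norm_le_pi_norm v i
        · exact norm_pder_le_norm_jet p u x i
    _ = n * ‖jet p u x‖ * ‖v‖ := by simp; ring

/-- Interpolation between `L^p` and `L^r` under bounds by a common quantity. -/
theorem eLpNorm_le_of_le_of_le {α E : Type*} [MeasurableSpace α] {μ : Measure α}
    [NormedAddCommGroup E] {f : α → E} (hf : AEStronglyMeasurable f μ) {p q r : ℝ} (hp : 0 < p)
    (hpq : p ≤ q) (hqr : q ≤ r) {A : ℝ≥0∞} {C : NNReal}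
    (h₁ : eLpNorm f (ENNReal.ofReal p) μ ≤ C * A)
    (h₂ : eLpNorm f (ENNReal.ofReal r) μ ≤ C * A) :
    eLpNorm f (ENNReal.ofReal q) μ ≤ C * A := by
  have key : ∀ s : ℝ, 0 < s → (eLpNorm f (ENNReal.ofReal s) μ ≤ C * A ↔
      ∫⁻ x, ‖f x‖ₑ ^ s ∂μ ≤ (C * A) ^ s) := fun s hs => by
    rw [eLpNorm_eq_lintegral_rpow_enorm_toReal (by simpa using hs) ENNReal.ofReal_ne_top,
      ENNReal.toReal_ofReal hs.le, one_div, ENNReal.rpow_inv_le_iff hs]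
  have hq := hp.trans_le hpq
  have hr := hq.trans_le hqr
  rw [key _ hp] at h₁
  rw [key _ hr] at h₂
  rw [key _ hq]
  rcases eq_or_lt_of_le (hpq.trans hqr) with hpr | hpr
  · obtain rfl : p = q := le_antisymm hpq (hqr.trans hpr.ge)
    exact h₁
  set t := (q - p) / (r - p) with ht
  have hrp : 0 < r - p := by linarith
  have ht0 : 0 ≤ t := div_nonneg (by linarith) hrp.le
  have ht1 : 0 ≤ 1 - t := by
    rw [sub_nonneg, ht, div_le_one hrp]; linarith
  have hq' : q = p * (1 - t) + r * t := by
    rw [ht]; field_simp; ring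
  calc ∫⁻ x, ‖f x‖ₑ ^ q ∂μ
      = ∫⁻ x, (‖f x‖ₑ ^ p) ^ (1 - t) * (‖f x‖ₑ ^ r) ^ t ∂μ := by
        refine lintegral_congr fun x => ?_
        rw [← ENNReal.rpow_mul, ← ENNReal.rpow_mul,
          ← ENNReal.rpow_add_of_nonneg _ _ (by positivity) (by positivity), ← hq']
    _ ≤ (∫⁻ x, ‖f x‖ₑ ^ p ∂μ) ^ (1 - t) * (∫⁻ x, ‖f x‖ₑ ^ r ∂μ) ^ t :=
        ENNReal.lintegral_mul_norm_pow_le (hf.enorm.pow_const _) (hf.enorm.pow_const _) ht1 ht0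
          (by ring)
    _ ≤ ((C * A) ^ p) ^ (1 - t) * ((C * A) ^ r) ^ t := by gcongr
    _ = (C * A) ^ q := by
        rw [← ENNReal.rpow_mul, ← ENNReal.rpow_mul,
          ← ENNReal.rpow_add_of_nonneg _ _ (by positivity) (by positivity), ← hq']

/-- A Sobolev inequality at the exponent `n p / (n - r)` for `r ≤ p`, obtained by applying the
Gagliardo–Nirenberg–Sobolev inequality with exponent `r` to `|u| ^ (p / r)`. -/
theorem exists_eLpNorm_le_eLpNorm_jet {n : ℕ} {p r : ℝ} [Fact (1 ≤ ENNReal.ofReal p)]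
    (hr : 1 ≤ r) (hrp : r ≤ p) (hrn : r < n) :
    ∃ C : NNReal, ∀ u : (Fin n → ℝ) → ℝ, ContDiff ℝ 1 u → HasCompactSupport u →
      eLpNorm u (ENNReal.ofReal (n * p / (n - r))) volume ≤
        C * eLpNorm (jet (ENNReal.ofReal p) u) (ENNReal.ofReal p) volume := by
  have hr0 : 0 < r := by linarith
  have hnr : 0 < n - r := by linarith
  have hn0 : (0 : ℝ) < n := by linarith
  set r' : ℝ := n * r / (n - r) with hr'
  have hr'0 : 0 < r' := by positivity
  have hfin : Module.finrank ℝ (Fin n → ℝ) = n := by simp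
  have gns : ∀ v : (Fin n → ℝ) → ℝ, ContDiff ℝ 1 v → HasCompactSupport v →
      eLpNorm v (ENNReal.ofReal r') volume ≤
        SNormLESNormFDerivOfEqConst ℝ (volume : Measure (Fin n → ℝ)) r *
          eLpNorm (fderiv ℝ v) (ENNReal.ofReal r) volume := fun v hv hv' => by
    have := eLpNorm_le_eLpNorm_fderiv_of_eq (volume : Measure (Fin n → ℝ)) hv hv'
      (p := r.toNNReal) (p' := r'.toNNReal) (by simpa using hr)
      (by rw [hfin]; exact_mod_cast hn0)
      (by
        have hr₁ : ((r.toNNReal⁻¹ : NNReal) : ℝ) = r⁻¹ := by simp [hr0.le]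
        rw [hfin, hr₁, Real.coe_toNNReal _ hr'0.le, hr']
        field_simp)
    rwa [Real.coe_toNNReal _ hr0.le] at this
  set K := SNormLESNormFDerivOfEqConst ℝ (volume : Measure (Fin n → ℝ)) r
  rcases hrp.eq_or_lt with rfl | hlt
  · refine ⟨K * n, fun u hu hu' => (gns u hu hu').trans ?_⟩
    rw [ENNReal.coe_mul, mul_assoc]
    gcongr
    exact eLpNorm_le_nnreal_smul_eLpNorm_of_ae_le_mul (f := fderiv ℝ u)
      (g := jet (ENNReal.ofReal r) u) (c := (n : NNReal))
      (ae_of_all _ fun x => by exact_mod_cast norm_fderiv_le_norm_jet (ENNReal.ofReal r) u x) _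
  · set s := p / r with hs
    have hs1 : 1 < s := by rw [hs, one_lt_div hr0]; exact hlt
    have hs0 : 0 < s := by linarith
    refine ⟨(K * (s.toNNReal * n)) ^ s⁻¹, fun u hu hu' => ?_⟩
    have hv := gns (fun x => ‖u x‖ ^ s) (hu.norm_rpow hs1)
      (hu'.comp_left (g := fun y : ℝ => ‖y‖ ^ s) (by simp [hs0.ne']))
    have hfd : eLpNorm (fderiv ℝ fun x => ‖u x‖ ^ s) (ENNReal.ofReal r) volume ≤
        (s.toNNReal * n : NNReal) *
          eLpNorm (jet (ENNReal.ofReal p) u) (ENNReal.ofReal p) volume ^ s := by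
      have h1 : ENNReal.ofReal p = ENNReal.ofReal r * ENNReal.ofReal s := by
        rw [← ENNReal.ofReal_mul hr0.le, hs]; congr 1; field_simp
      have h2 := eLpNorm_norm_rpow (p := ENNReal.ofReal r) (μ := volume)
        (jet (ENNReal.ofReal p) u) hs0
      rw [← h1] at h2
      rw [← h2]
      refine (eLpNorm_le_nnreal_smul_eLpNorm_of_ae_le_mul (c := s.toNNReal * n)
        (ae_of_all _ fun x => ?_) _).trans_eq rfl
      rw [← NNReal.coe_le_coe]
      push_cast
      rw [Real.coe_toNNReal _ hs0.le, Real.norm_of_nonneg (by positivity)]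
      calc _ ≤ s * ‖u x‖ ^ (s - 1) * ‖fderiv ℝ u x‖ :=
            norm_fderiv_norm_rpow_le (hu.differentiable one_ne_zero) hs1
        _ ≤ s * ‖jet (ENNReal.ofReal p) u x‖ ^ (s - 1) *
              (n * ‖jet (ENNReal.ofReal p) u x‖) := by
            gcongr
            · exact norm_le_norm_jet _ u x
            · exact norm_fderiv_le_norm_jet _ u x
        _ = s * n * (‖jet (ENNReal.ofReal p) u x‖ ^ (s - 1) *
              ‖jet (ENNReal.ofReal p) u x‖ ^ (1 : ℝ)) := by rw [Real.rpow_one]; ring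
        _ = _ := by
            rw [← Real.rpow_add_of_nonneg (norm_nonneg _) (by linarith) zero_le_one]; simp
    rw [eLpNorm_norm_rpow _ hs0, ← ENNReal.ofReal_mul hr'0.le] at hv
    have hexp : r' * s = n * p / (n - r) := by rw [hr', hs]; field_simp
    rw [hexp] at hv
    have := hv.trans (mul_le_mul_right hfd _)
    rw [← mul_assoc, ← ENNReal.coe_mul, ← ENNReal.le_rpow_inv_iff hs0,
      ENNReal.mul_rpow_of_nonneg _ _ (by positivity), ← ENNReal.rpow_mul,
      mul_inv_cancel₀ hs0.ne', ENNReal.rpow_one] at this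
    rwa [ENNReal.coe_rpow_of_nonneg _ (by positivity)]

/-- The Sobolev inequality for `C¹` functions with compact support on `ℝⁿ`. -/
theorem exists_sobolev_inequality {n : ℕ} (hn : 2 ≤ n) {p q : ℝ} [Fact (1 ≤ ENNReal.ofReal p)]
    (hp : 1 ≤ p)
    (hpq : (p < n ∧ p ≤ q ∧ q ≤ n * p / (n - p)) ∨ ((n : ℝ) ≤ p ∧ p ≤ q)) :
    ∃ C : NNReal, ∀ u : (Fin n → ℝ) → ℝ, ContDiff ℝ 1 u → HasCompactSupport u →
      eLpNorm u (ENNReal.ofReal q) volume ≤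
        C * eLpNorm (jet (ENNReal.ofReal p) u) (ENNReal.ofReal p) volume := by
  have hn' : (2 : ℝ) ≤ n := by exact_mod_cast hn
  obtain ⟨r, hr, hrp, hrn, hpq', hq⟩ : ∃ r : ℝ, 1 ≤ r ∧ r ≤ p ∧ r < n ∧ p ≤ q ∧
      q ≤ n * p / (n - r) := by
    rcases hpq with ⟨h1, h2, h3⟩ | ⟨h1, h2⟩
    · exact ⟨p, hp, le_rfl, h1, h2, h3⟩
    · have hq0 : 0 < q := by linarith
      have hlt : max 1 (n - n * p / q) < n := max_lt (by linarith) (by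
        have : 0 < n * p / q := by positivity
        linarith)
      refine ⟨max 1 (n - n * p / q), le_max_left _ _, hlt.le.trans h1, hlt, h2, ?_⟩
      rw [le_div_iff₀ (by linarith)]
      calc q * (n - max 1 (n - n * p / q)) ≤ q * (n * p / q) := by
            gcongr
            have := le_max_right 1 (n - n * p / q)
            linarith
        _ = n * p := by field_simp
  obtain ⟨C, hC⟩ := exists_eLpNorm_le_eLpNorm_jet hr hrp hrn
  refine ⟨max 1 C, fun u hu hu' => eLpNorm_le_of_le_of_le hu.continuous.aestronglyMeasurable
    (by linarith) hpq' hq ?_ ?_⟩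
  · calc eLpNorm u (ENNReal.ofReal p) volume
        ≤ eLpNorm (jet (ENNReal.ofReal p) u) (ENNReal.ofReal p) volume :=
          eLpNorm_mono (norm_le_norm_jet _ u)
      _ ≤ _ := le_mul_of_one_le_left zero_le (by exact_mod_cast le_max_left 1 C)
  · refine (hC u hu hu').trans ?_
    gcongr
    exact le_max_right 1 C

theorem continuous_jet {n : ℕ} {p : ℝ≥0∞} {u : (Fin n → ℝ) → ℝ} (hu : ContDiff ℝ 1 u) :
    Continuous (jet p u) := by
  refine (PiLp.continuous_toLp p (fun _ : Fin (n + 1) => ℝ)).comp (continuous_pi fun i => ?_)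
  refine Fin.cases ?_ (fun i => ?_) i
  · simpa using hu.continuous
  · simpa [pder] using (hu.continuous_fderiv one_ne_zero).clm_apply continuous_const

theorem hasCompactSupport_jet {n : ℕ} {p : ℝ≥0∞} {u : (Fin n → ℝ) → ℝ}
    (hu : HasCompactSupport u) : HasCompactSupport (jet p u) := by
  refine HasCompactSupport.intro hu fun x hx => ?_
  have h : Fin.cons (u x) (fun i => pder i u x) = (0 : Fin (n + 1) → ℝ) := by
    funext i
    refine Fin.cases ?_ (fun i => ?_) i
    · simpa using image_eq_zero_of_notMem_tsupport hx
    · simp [pder, fderiv_of_notMem_tsupport ℝ hx]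
  simp [jet, h]

theorem memLp_jet {n : ℕ} {p : ℝ≥0∞} [Fact (1 ≤ p)] {D : Set (Fin n → ℝ)} {u : (Fin n → ℝ) → ℝ}
    (hu : IsTestFun D u) : MemLp (jet p u) p (volume : Measure (Fin n → ℝ)) :=
  (continuous_jet (contDiff_one_of_isTestFun hu)).memLp_of_hasCompactSupport
    (hasCompactSupport_jet hu.2.1)

theorem jet_add {n : ℕ} {p : ℝ≥0∞} {u v : (Fin n → ℝ) → ℝ} (hu : ContDiff ℝ 1 u)
    (hv : ContDiff ℝ 1 v) : jet p (u + v) = jet p u + jet p v := by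
  funext x
  refine PiLp.ext fun i => Fin.cases ?_ (fun i => ?_) i
  · simp [jet]
  · simp [jet, pder, fderiv_add (hu.differentiable one_ne_zero x)
      (hv.differentiable one_ne_zero x)]

theorem jet_const_smul {n : ℕ} {p : ℝ≥0∞} (c : ℝ) {u : (Fin n → ℝ) → ℝ} (hu : ContDiff ℝ 1 u) :
    jet p (c • u) = c • jet p u := by
  funext x
  refine PiLp.ext fun i => Fin.cases ?_ (fun i => ?_) i
  · simp [jet]
  · simp [jet, pder, fderiv_const_smul (hu.differentiable one_ne_zero x)]

theorem jet_comp_sub {n : ℕ} {p : ℝ≥0∞} (u : (Fin n → ℝ) → ℝ) (a : Fin n → ℝ) :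
    jet p (fun x => u (x - a)) = fun x => jet p u (x - a) := by
  funext x
  simp [jet, pder, fderiv_comp_sub]

/-- The linear span of jets of test functions consists of jets of test functions. -/
theorem exists_isTestFun_of_mem_span {n : ℕ} {p : ℝ≥0∞} [Fact (1 ≤ p)] {D : Set (Fin n → ℝ)}
    {f : Vsp n p} (hf : f ∈ Submodule.span ℝ {f : Vsp n p | ∃ u : (Fin n → ℝ) → ℝ,
      IsTestFun D u ∧ (f : (Fin n → ℝ) → PiLp p (fun _ : Fin (n + 1) => ℝ)) =ᵐ[volume] jet p u}) :
    ∃ u : (Fin n → ℝ) → ℝ, IsTestFun D u ∧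
      (f : (Fin n → ℝ) → PiLp p (fun _ : Fin (n + 1) => ℝ)) =ᵐ[volume] jet p u := by
  induction hf using Submodule.span_induction with
  | mem f hf => exact hf
  | zero =>
    refine ⟨0, ⟨contDiff_const, HasCompactSupport.zero, by simp⟩, ?_⟩
    have h0 := jet_const_smul (n := n) (p := p) 0 (u := 0) contDiff_const
    rw [zero_smul, zero_smul] at h0
    rw [h0]
    exact Lp.coeFn_zero _ _ _
  | add f g _ _ hf hg =>
    obtain ⟨u, hu, hfu⟩ := hf
    obtain ⟨v, hv, hgv⟩ := hg
    refine ⟨u + v, ⟨hu.1.add hv.1, hu.2.1.add hv.2.1,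
      (tsupport_add u v).trans (union_subset hu.2.2 hv.2.2)⟩, ?_⟩
    rw [jet_add (contDiff_one_of_isTestFun hu) (contDiff_one_of_isTestFun hv)]
    exact (Lp.coeFn_add f g).trans (hfu.add hgv)
  | smul c f _ hf =>
    obtain ⟨u, hu, hfu⟩ := hf
    refine ⟨c • u, ⟨hu.1.const_smul c, hu.2.1.smul_left (f := fun _ => c),
      (tsupport_smul_subset_right (fun _ => c) u).trans hu.2.2⟩, ?_⟩
    rw [jet_const_smul c (contDiff_one_of_isTestFun hu)]
    exact (Lp.coeFn_smul c f).trans (hfu.const_smul c)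

/-- The class in `W₀^{1,p}(D)` of a test function. -/
noncomputable def testJet {n : ℕ} (p : ℝ≥0∞) [Fact (1 ≤ p)] {D : Set (Fin n → ℝ)} {u : (Fin n → ℝ) → ℝ}
    (hu : IsTestFun D u) : W0sub p D :=
  ⟨(memLp_jet hu).toLp _, Submodule.le_topologicalClosure _
    (Submodule.subset_span ⟨u, hu, MemLp.coeFn_toLp _⟩)⟩

theorem enorm_testJet {n : ℕ} {p : ℝ≥0∞} [Fact (1 ≤ p)] {D : Set (Fin n → ℝ)}
    {u : (Fin n → ℝ) → ℝ} (hu : IsTestFun D u) :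
    ‖testJet p hu‖ₑ = eLpNorm (jet p u) p volume :=
  Lp.enorm_toLp (memLp_jet hu)

theorem proj0_compLpL_ae_eq {n : ℕ} {p : ℝ≥0∞} [Fact (1 ≤ p)] {f : Vsp n p}
    {u : (Fin n → ℝ) → ℝ}
    (h : (f : (Fin n → ℝ) → PiLp p (fun _ : Fin (n + 1) => ℝ)) =ᵐ[volume] jet p u) :
    ((proj0 n p).compLpL p volume f : (Fin n → ℝ) → ℝ) =ᵐ[volume] u := by
  filter_upwards [h, (proj0 n p).coeFn_compLpL f] with x hx hx'
  rw [hx', hx]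
  rfl

/-- An `L^q` bound on test functions extends to all of `W₀^{1,p}(D)`. -/
theorem eLpNorm_proj0_le_of_forall_isTestFun {n : ℕ} {p q : ℝ≥0∞} [Fact (1 ≤ p)]
    {D : Set (Fin n → ℝ)} {K : NNReal}
    (h : ∀ u : (Fin n → ℝ) → ℝ, IsTestFun D u →
      eLpNorm u q volume ≤ K * eLpNorm (jet p u) p volume) (f : W0sub (n := n) p D) :
    eLpNorm ((proj0 n p).compLpL p volume (f : Vsp n p)) q volume ≤ K * ‖f‖ₑ := by
  obtain ⟨x, hx, hxf⟩ := mem_closure_iff_seq_limit.1 f.2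
  have hP := (((proj0 n p).compLpL p
    (volume : Measure (Fin n → ℝ))).continuous.tendsto (f : Vsp n p)).comp hxf
  obtain ⟨ns, hns, hae⟩ := (tendstoInMeasure_of_tendsto_Lp hP).exists_seq_tendsto_ae
  have hlim : Tendsto (fun j => (K : ℝ≥0∞) * ‖x (ns j)‖ₑ) atTop (𝓝 (K * ‖f‖ₑ)) :=
    ENNReal.Tendsto.const_mul ((hxf.comp hns.tendsto_atTop).enorm) (Or.inr ENNReal.coe_ne_top)
  refine (Lp.eLpNorm_lim_le_liminf_eLpNorm (fun j => Lp.aestronglyMeasurable _) _ hae).trans ?_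
  rw [← hlim.liminf_eq]
  refine liminf_le_liminf (Eventually.of_forall fun j => ?_)
  obtain ⟨u, hu, hxu⟩ := exists_isTestFun_of_mem_span (hx (ns j))
  rw [Function.comp_apply, eLpNorm_congr_ae (proj0_compLpL_ae_eq hxu), Lp.enorm_def,
    eLpNorm_congr_ae hxu]
  exact h u hu

/-- Far translates of a compactly supported function are almost at least as far from any given
finite family in `L^q` as from zero. -/
theorem exists_translate_eLpNorm_le {n : ℕ} {q : ℝ≥0∞} [Fact (1 ≤ q)] (hq : q ≠ ∞)
    {ι : Type*} [Finite ι] (c : ι → Lp ℝ q (volume : Measure (Fin n → ℝ)))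
    {u : (Fin n → ℝ) → ℝ} (hu : Continuous u) (hu' : HasCompactSupport u)
    {e : Fin n → ℝ} (he : ‖e‖ = 1) {δ : ℝ≥0∞} (hδ : δ ≠ 0) :
    ∃ t : ℝ, ∀ i, eLpNorm u q volume ≤
      eLpNorm ((fun x => u (x - t • e)) - ⇑(c i)) q volume + δ := by
  choose g hg hgδ hgc hgm using fun i =>
    (Lp.memLp (c i)).exists_hasCompactSupport_eLpNorm_sub_le hq hδ
  obtain ⟨R, hR⟩ := (hu'.isCompact.union (isCompact_iUnion fun i => (hg i).isCompact)).isBounded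
    |>.exists_norm_le
  have hut : Continuous fun x => u (x - (2 * R + 1) • e) := by fun_prop
  refine ⟨2 * R + 1, fun i => ?_⟩
  calc eLpNorm u q volume = eLpNorm (fun x => u (x - (2 * R + 1) • e)) q volume :=
        (eLpNorm_comp_measurePreserving hu.aestronglyMeasurable
          (measurePreserving_sub_right volume ((2 * R + 1) • e))).symm
    _ ≤ eLpNorm ((fun x => u (x - (2 * R + 1) • e)) - g i) q volume := by
        refine eLpNorm_mono fun x => ?_
        by_cases h1 : u (x - (2 * R + 1) • e) = 0
        · simp [h1]
        · have h2 : g i x = 0 := by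
            by_contra h2
            have h3 := hR _ (Or.inl (subset_tsupport _ h1))
            have h4 := hR x (Or.inr (mem_iUnion.2 ⟨i, subset_tsupport _ h2⟩))
            have h5 : ‖(2 * R + 1) • e‖ = 2 * R + 1 := by
              rw [norm_smul, he, mul_one, Real.norm_of_nonneg]
              linarith [norm_nonneg x]
            have h6 := norm_sub_norm_le ((2 * R + 1) • e) x
            rw [norm_sub_rev] at h6
            linarith
          simp [h2]
    _ = eLpNorm (((fun x => u (x - (2 * R + 1) • e)) - ⇑(c i)) + (⇑(c i) - g i)) q volume := by
        rw [sub_add_sub_cancel]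
    _ ≤ eLpNorm ((fun x => u (x - (2 * R + 1) • e)) - ⇑(c i)) q volume +
          eLpNorm (⇑(c i) - g i) q volume :=
        eLpNorm_add_le (hut.aestronglyMeasurable.sub (Lp.aestronglyMeasurable _))
          ((Lp.aestronglyMeasurable _).sub (hgc i).aestronglyMeasurable) Fact.out
    _ ≤ _ := by gcongr; exact hgδ i

theorem isTestFun_comp_sub {n : ℕ} {D : Set (Fin n → ℝ)} {u : (Fin n → ℝ) → ℝ}
    (hu : IsTestFun D u) {a : Fin n → ℝ} (ha : ∀ x, x - a ∈ D → x ∈ D) :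
    IsTestFun D (fun x => u (x - a)) := by
  refine ⟨hu.1.comp (contDiff_id.sub contDiff_const),
    hu.2.1.comp_homeomorph (Homeomorph.subRight a), fun x hx => ha x (hu.2.2 ?_)⟩
  exact tsupport_comp_subset_preimage u (f := fun x => x - a) (by fun_prop) hx

/-- An embedding of `W₀^{1,p}(D)` into `L^q` is maximally noncompact if `D` is invariant under
translations along some direction. -/
theorem entropyNumber_eq_norm_of_translation_invariant {n : ℕ} {p q : ℝ≥0∞} [Fact (1 ≤ p)]
    [Fact (1 ≤ q)] (hq : q ≠ ∞) {D : Set (Fin n → ℝ)} {e : Fin n → ℝ} (he : ‖e‖ = 1)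
    (hD : ∀ (t : ℝ) (x : Fin n → ℝ), x - t • e ∈ D → x ∈ D)
    (I : W0sub (n := n) p D →L[ℝ] Lp ℝ q (volume : Measure (Fin n → ℝ)))
    (hI : ∀ f : W0sub (n := n) p D, I f =ᵐ[volume] (proj0 n p).compLpL p volume (f : Vsp n p))
    (m : ℕ) : entropyNumber m I = ‖I‖ := by
  have hbdd : BddBelow {ε : ℝ | 0 < ε ∧ ∃ c : Fin (2 ^ (m - 1)) → Lp ℝ q volume,
      ∀ x : W0sub (n := n) p D, ‖x‖ ≤ 1 → ∃ j, ‖I x - c j‖ ≤ ε} := ⟨0, fun ε hε => hε.1.le⟩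
  have hmem : ∀ δ : ℝ, 0 < δ → ‖I‖ + δ ∈ {ε : ℝ | 0 < ε ∧
      ∃ c : Fin (2 ^ (m - 1)) → Lp ℝ q volume,
        ∀ x : W0sub (n := n) p D, ‖x‖ ≤ 1 → ∃ j, ‖I x - c j‖ ≤ ε} := fun δ hδ =>
    ⟨by positivity, 0, fun x hx => ⟨⟨0, by positivity⟩, by
      simpa using (I.unit_le_opNorm x hx).trans (by linarith)⟩⟩
  refine le_antisymm (le_of_forall_pos_le_add fun δ hδ => csInf_le hbdd (hmem δ hδ))
    (le_csInf ⟨_, hmem 1 one_pos⟩ ?_)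
  rintro ε ⟨hε, c, hc⟩
  have htest : ∀ u : (Fin n → ℝ) → ℝ, IsTestFun D u →
      eLpNorm u q volume ≤ ε.toNNReal * eLpNorm (jet p u) p volume := fun u hu => by
    rw [← enorm_testJet hu]
    have hM : ∀ M : ℝ, ‖testJet p hu‖ < M → eLpNorm u q volume ≤ ENNReal.ofReal (M * ε) := by
      intro M hM
      have hM0 : 0 < M := (norm_nonneg _).trans_lt hM
      refine ENNReal.le_of_forall_pos_le_add fun δ hδ _ => ?_
      obtain ⟨t, ht⟩ := exists_translate_eLpNorm_le hq (fun i => M • c i) hu.1.continuous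
        hu.2.1 he (ENNReal.coe_ne_zero.2 hδ.ne')
      have hut := isTestFun_comp_sub hu (hD t)
      have hnorm : ‖testJet p hut‖ = ‖testJet p hu‖ := by
        rw [← toReal_enorm, ← toReal_enorm, enorm_testJet, enorm_testJet, jet_comp_sub]
        congr 1
        exact eLpNorm_comp_measurePreserving (memLp_jet hu).1
          (measurePreserving_sub_right volume (t • e))
      obtain ⟨j, hj⟩ := hc (M⁻¹ • testJet p hut) (by
        rw [norm_smul, hnorm, norm_inv, Real.norm_of_nonneg hM0.le, inv_mul_le_one₀ hM0]
        exact hM.le)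
      refine (ht j).trans ?_
      gcongr
      have hle : ‖I (testJet p hut) - M • c j‖ ≤ M * ε := by
        have : I (testJet p hut) - M • c j = M • (I (M⁻¹ • testJet p hut) - c j) := by
          rw [map_smul, smul_sub, smul_inv_smul₀ hM0.ne']
        rw [this, norm_smul, Real.norm_of_nonneg hM0.le]
        gcongr
      have hae : (fun x => u (x - t • e)) - ⇑(M • c j : Lp ℝ q volume) =ᵐ[volume]
          ⇑(I (testJet p hut) - M • c j : Lp ℝ q volume) := by
        have h1 := (hI (testJet p hut)).trans
          (proj0_compLpL_ae_eq (MemLp.coeFn_toLp (memLp_jet hut)))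
        exact (h1.symm.sub (EventuallyEq.refl _ _)).trans (Lp.coeFn_sub _ _).symm
      rw [eLpNorm_congr_ae hae, ← Lp.enorm_def, ← ofReal_norm]
      exact ENNReal.ofReal_le_ofReal hle
    have hlim : Tendsto (fun M : ℝ => ENNReal.ofReal (M * ε)) (𝓝[>] ‖testJet p hu‖)
        (𝓝 (ENNReal.ofReal (‖testJet p hu‖ * ε))) := by
      refine (Continuous.tendsto ?_ _).mono_left nhdsWithin_le_nhds
      exact ENNReal.continuous_ofReal.comp (by fun_prop)
    refine (ge_of_tendsto hlim ?_).trans_eq ?_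
    · filter_upwards [self_mem_nhdsWithin] with M hM' using hM M hM'
    rw [ENNReal.ofReal_mul (norm_nonneg _), ofReal_norm, mul_comm]
    rfl
  refine I.opNorm_le_bound hε.le fun f => ?_
  have h := eLpNorm_proj0_le_of_forall_isTestFun htest f
  rw [← eLpNorm_congr_ae (hI f), ← Lp.enorm_def, ← ofReal_norm, ← ofReal_norm f,
    ← ENNReal.ofReal, ← ENNReal.ofReal_mul hε.le] at h
  exact (ENNReal.ofReal_le_ofReal_iff (by positivity)).1 h

/-- A Sobolev inequality for test functions yields the bounded canonical embedding of
`W₀^{1,p}(D)` into `L^q`. -/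
theorem exists_canonical_embedding {n : ℕ} {p q : ℝ≥0∞} [Fact (1 ≤ p)] [Fact (1 ≤ q)]
    {D : Set (Fin n → ℝ)} {K : NNReal}
    (h : ∀ u : (Fin n → ℝ) → ℝ, IsTestFun D u →
      eLpNorm u q volume ≤ K * eLpNorm (jet p u) p volume) :
    ∃ I : W0sub (n := n) p D →L[ℝ] Lp ℝ q (volume : Measure (Fin n → ℝ)),
      ∀ f : W0sub (n := n) p D, I f =ᵐ[volume] (proj0 n p).compLpL p volume (f : Vsp n p) := by
  set P : W0sub (n := n) p D →L[ℝ] Lp ℝ p (volume : Measure (Fin n → ℝ)) := SobolevEmb p D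
  have hle : ∀ f, eLpNorm (P f) q volume ≤ K * ‖f‖ₑ := eLpNorm_proj0_le_of_forall_isTestFun h
  have hP : ∀ f, MemLp (P f) q volume := fun f => ⟨Lp.aestronglyMeasurable _,
    (hle f).trans_lt (ENNReal.mul_lt_top ENNReal.coe_lt_top enorm_lt_top)⟩
  let L : W0sub (n := n) p D →ₗ[ℝ] Lp ℝ q (volume : Measure (Fin n → ℝ)) :=
    { toFun := fun f => (hP f).toLp _
      map_add' := fun f g => by
        rw [← MemLp.toLp_add, MemLp.toLp_eq_toLp_iff, map_add]
        exact Lp.coeFn_add _ _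
      map_smul' := fun c f => by
        rw [RingHom.id_apply, ← MemLp.toLp_const_smul, MemLp.toLp_eq_toLp_iff, map_smul]
        exact Lp.coeFn_smul _ _ }
  refine ⟨L.mkContinuous K fun f => ?_, fun f => MemLp.coeFn_toLp (hP f)⟩
  have h1 : ‖L f‖ₑ ≤ K * ‖f‖ₑ := (Lp.enorm_toLp (hP f)).trans_le (hle f)
  rw [← ofReal_norm, ← ofReal_norm f, ← ENNReal.ofReal_coe_nnreal,
    ← ENNReal.ofReal_mul K.coe_nonneg] at h1
  exact (ENNReal.ofReal_le_ofReal_iff (by positivity)).1 h1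

/-- For the strip-like domain `D = ℝᵏ × ∏_{i=1}^{n-k} (aᵢ,bᵢ)` and exponents
`p ∈ [1,n), q ∈ [p, np/(n-p)]` or `p ∈ [n,∞), q ∈ [p,∞)`, the canonical Sobolev embedding
`I : W₀^{1,p}(D) ↪ L^q(D)` is bounded (it is the unique bounded operator sending each test
function to itself) and maximally noncompact: `e_m(I) = ‖I‖` for every `m`. -/
theorem sobolevEmbedding_Lq_stripDomain_maximally_noncompact
    (n k : ℕ) (hn : 2 ≤ n) (hk1 : 1 ≤ k) (hk : k < n) (p q : ℝ) (hp : 1 ≤ p)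
    (hpq : (p < n ∧ p ≤ q ∧ q ≤ n * p / (n - p)) ∨ ((n : ℝ) ≤ p ∧ p ≤ q))
    (a b : Fin n → ℝ) (hab : ∀ i : Fin n, k ≤ (i : ℕ) → a i < b i) :
    letI : Fact (1 ≤ ENNReal.ofReal p) := ⟨ENNReal.one_le_ofReal.mpr hp⟩
    letI : Fact (1 ≤ ENNReal.ofReal q) :=
      ⟨ENNReal.one_le_ofReal.mpr (hp.trans (hpq.elim (fun h => h.2.1) (fun h => h.2)))⟩
    ∃ I : W0sub (ENNReal.ofReal p) (stripDomain n k a b) →L[ℝ]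
        Lp ℝ (ENNReal.ofReal q) (volume : Measure (Fin n → ℝ)),
      -- `I` is the canonical embedding: it maps (the jet of) each test function `u` to `u`
      (∀ (f : W0sub (ENNReal.ofReal p) (stripDomain n k a b)) (u : (Fin n → ℝ) → ℝ),
        IsTestFun (stripDomain n k a b) u →
        ((f : Vsp n (ENNReal.ofReal p)) :
            (Fin n → ℝ) → PiLp (ENNReal.ofReal p) (fun _ : Fin (n + 1) => ℝ)) =ᵐ[volume]
          jet (ENNReal.ofReal p) u →
        ⇑(I f) =ᵐ[volume] u) ∧
      -- `I` is maximally noncompact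
      ∀ m : ℕ, 1 ≤ m → entropyNumber m I = ‖I‖ := by
  have : Fact (1 ≤ ENNReal.ofReal p) := ⟨ENNReal.one_le_ofReal.mpr hp⟩
  have : Fact (1 ≤ ENNReal.ofReal q) :=
    ⟨ENNReal.one_le_ofReal.mpr (hp.trans (hpq.elim (fun h => h.2.1) (fun h => h.2)))⟩
  obtain ⟨C, hC⟩ := exists_sobolev_inequality hn hp hpq
  obtain ⟨I, hI⟩ := exists_canonical_embedding (D := stripDomain n k a b) fun u hu =>
    hC u (contDiff_one_of_isTestFun hu) hu.2.1
  have hD : ∀ (t : ℝ) (x : Fin n → ℝ),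
      x - t • (Pi.single ⟨0, by omega⟩ 1 : Fin n → ℝ) ∈ stripDomain n k a b →
        x ∈ stripDomain n k a b := fun t x hx i hi => by
    have hi0 : i ≠ ⟨0, by omega⟩ := fun h => by
      rw [h] at hi
      simp at hi
      omega
    simpa [hi0] using hx i hi
  exact ⟨I, fun f u _ hfu => (hI f).trans (proj0_compLpL_ae_eq hfu), fun m _ =>
    entropyNumber_eq_norm_of_translation_invariant ENNReal.ofReal_ne_top
      (e := Pi.single ⟨0, by omega⟩ 1)
      (by rw [Pi.norm_single, norm_one]) hD I hI m⟩
end
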